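/- arXiv:2401.00783 — 2 statements merged into one kernel-verified Lean document; each statement's English description precedes it below -/
import Mathlib

section
/- Let k be an algebraically closed field of prime characteristic p and δ ≥ 2. For e ≥ 1 let a_e be the largest integer n such that the free module R^n is a direct summand of the R-module ^eR. Then the F-signature of R equals 1/δ; that is, a_e / p^(2e) converges to 1/δ as e → ∞. -/
open MvPolynomial CategoryTheory Filter

set_option synthInstance.maxHeartbeats 1000000
set_option maxHeartbeats 2000000

noncomputable section

variable (k : Type) [Field k]

/-- The δ-th Veronese subalgebra `R = k[x^δ, x^(δ-1)y, …, y^δ]` of `S = k[x,y]`. -/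
def Rver (δ : ℕ) : Subalgebra k (MvPolynomial (Fin 2) k) :=
  Algebra.adjoin k { g : MvPolynomial (Fin 2) k | ∃ i ≤ δ, g = X 0 ^ (δ - i) * X 1 ^ i }

/-- The `e`-th iterated Frobenius endomorphism `r ↦ r^(p^e)` of `R`. -/
def frobR (δ : ℕ) (p : ℕ) [Fact p.Prime] [CharP k p] (e : ℕ) :
    ↥(Rver k δ) →+* ↥(Rver k δ) :=
  letI : CharP ↥(Rver k δ) p :=
    CharP.subsemiring (MvPolynomial (Fin 2) k) p (Rver k δ).toSubsemiring
  iterateFrobenius ↥(Rver k δ) p e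

/-- `^eR` : `R` viewed as an `R`-module by restriction of scalars along the `e`-th iterate
of the Frobenius endomorphism. -/
def eR (δ : ℕ) (p : ℕ) [Fact p.Prime] [CharP k p] (e : ℕ) : ModuleCat ↥(Rver k δ) :=
  (ModuleCat.restrictScalars (frobR k δ p e)).obj (ModuleCat.of ↥(Rver k δ) ↥(Rver k δ))

/-- The exponent vector of `x^i y^j`. -/
def expo (t : ℕ × ℕ) : Fin 2 →₀ ℕ := Finsupp.single 0 t.1 + Finsupp.single 1 t.2

@[simp] lemma expo_zero (t : ℕ × ℕ) : expo t 0 = t.1 := by simp [expo]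

@[simp] lemma expo_one (t : ℕ × ℕ) : expo t 1 = t.2 := by simp [expo]

lemma fin2_ext {m n : Fin 2 →₀ ℕ} (h0 : m 0 = n 0) (h1 : m 1 = n 1) : m = n := by
  ext i
  fin_cases i
  · exact h0
  · exact h1

lemma monomial_mem_Rver {δ : ℕ} (m : Fin 2 →₀ ℕ) (c : k)
    (hm : δ ∣ m 0 + m 1) : monomial m c ∈ Rver k δ := by
  obtain ⟨n, hn⟩ := hm
  induction n generalizing m c with
  | zero =>
    have : m = 0 := fin2_ext (by simp; omega) (by simp; omega)
    rw [this]
    exact (Rver k δ).algebraMap_mem c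
  | succ n ih =>
    obtain ⟨i, j, hi, hj, hij⟩ : ∃ i j, i ≤ m 0 ∧ j ≤ m 1 ∧ i + j = δ := by
      refine ⟨min (m 0) δ, δ - min (m 0) δ, by omega, ?_, by omega⟩
      have : δ ≤ m 0 + m 1 := by rw [hn]; exact Nat.le_mul_of_pos_right _ (by omega)
      omega
    have h1 : monomial m c = monomial (expo (m 0 - i, m 1 - j)) c * monomial (expo (i, j)) 1 := by
      rw [monomial_mul, mul_one]
      congr 2
      exact fin2_ext (by simp; omega) (by simp; omega)
    rw [h1]
    refine mul_mem (ih _ _ ?_) (Algebra.subset_adjoin ⟨j, by omega, ?_⟩)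
    · simp only [expo_zero, expo_one]
      rw [Nat.mul_succ] at hn
      omega
    · rw [show δ - j = i by omega, X_pow_eq_monomial, X_pow_eq_monomial, monomial_mul, mul_one]
      rfl

lemma dvd_of_coeff_ne_zero {δ : ℕ} {f : MvPolynomial (Fin 2) k} (hf : f ∈ Rver k δ) :
    ∀ m, coeff m f ≠ 0 → δ ∣ m 0 + m 1 := by
  induction hf using Algebra.adjoin_induction with
  | mem g hg =>
    obtain ⟨i, hi, rfl⟩ := hg
    intro m hm
    rw [X_pow_eq_monomial, X_pow_eq_monomial, monomial_mul, coeff_monomial] at hm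
    split_ifs at hm with h
    · rw [← h]
      simp [hi]
    · exact absurd rfl hm
  | algebraMap r =>
    intro m hm
    rw [algebraMap_eq, coeff_C] at hm
    split_ifs at hm with h
    · simp [← h]
    · exact absurd rfl hm
  | add f g _ _ hf hg =>
    intro m hm
    by_cases h : coeff m f = 0
    · exact hg m (by rwa [coeff_add, h, zero_add] at hm)
    · exact hf m h
  | mul f g _ _ hf hg =>
    intro m hm
    rw [coeff_mul] at hm
    obtain ⟨x, hx, hne⟩ := Finset.exists_ne_zero_of_sum_ne_zero hm
    rw [← Finset.HasAntidiagonal.mem_antidiagonal.1 hx]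
    have h := dvd_add (hf _ (left_ne_zero_of_mul hne)) (hg _ (right_ne_zero_of_mul hne))
    rwa [add_add_add_comm] at h

/-- An additive map `φ : R → R` satisfying `φ (r ^ q * s) = r * φ s` sends every monomial
divisible by `x ^ q` or `y ^ q` into the maximal ideal. -/
lemma coeff_zero_eq_zero {δ q : ℕ} (hδ : 0 < δ) (hq : 0 < q)
    (φ : ↥(Rver k δ) → ↥(Rver k δ)) (hφ : ∀ r s, φ (r ^ q * s) = r * φ s)
    (m : Fin 2 →₀ ℕ) (c : k) (hm : q ≤ m 0 ∨ q ≤ m 1) (s : ↥(Rver k δ))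
    (hs : (s : MvPolynomial (Fin 2) k) = monomial m c) (hd : δ ∣ m 0 + m 1) :
    coeff 0 (φ s : MvPolynomial (Fin 2) k) = 0 := by
  set a := m 0 / q with ha
  set b := m 1 / q with hb
  have hab : 1 ≤ a + b := by
    rcases hm with h | h
    · exact Nat.le_add_right_of_le ((Nat.one_le_div_iff hq).2 h)
    · exact Nat.le_add_left_of_le ((Nat.one_le_div_iff hq).2 h)
  have h0 : q * a + m 0 % q = m 0 := Nat.div_add_mod _ _
  have h1 : q * b + m 1 % q = m 1 := Nat.div_add_mod _ _
  obtain ⟨a', b', hne, hsum⟩ : ∃ a' b', a ≠ a' ∧ a' + b' = a + b := by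
    rcases Nat.eq_zero_or_pos a with h | h
    · exact ⟨1, a + b - 1, by omega, by omega⟩
    · exact ⟨0, a + b, by omega, by omega⟩
  have hs'd : δ ∣ (q * a' + m 0 % q) + (q * b' + m 1 % q) := by
    have : (q * a' + m 0 % q) + (q * b' + m 1 % q) = m 0 + m 1 := by
      rw [← h0, ← h1]
      have : q * a' + q * b' = q * a + q * b := by rw [← mul_add, ← mul_add, hsum]
      simp only [Nat.mul_add_mod, Nat.mod_mod]
      omega
    rwa [this]
  let e := (δ - 1) * (a + b)
  have hed : δ ∣ e + (a + b) := ⟨a + b, by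
    obtain ⟨d, rfl⟩ : ∃ d, δ = d + 1 := ⟨δ - 1, by omega⟩
    simp only [e, Nat.add_sub_cancel]
    ring⟩
  let w : MvPolynomial (Fin 2) k := monomial (expo (e, 0)) 1
  let u : MvPolynomial (Fin 2) k := monomial (expo (a, b)) 1
  let v : MvPolynomial (Fin 2) k := monomial (expo (a', b')) 1
  have hwu : w * u ∈ Rver k δ := by
    rw [monomial_mul]
    apply monomial_mem_Rver k
    simpa [add_assoc] using hed
  have hwv : w * v ∈ Rver k δ := by
    rw [monomial_mul]
    apply monomial_mem_Rver k
    simpa [add_assoc, hsum] using hed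
  have hs' : monomial (expo (q * a' + m 0 % q, q * b' + m 1 % q)) c ∈ Rver k δ := by
    apply monomial_mem_Rver k
    simpa using hs'd
  have key : (⟨w * v, hwv⟩ : ↥(Rver k δ)) ^ q * s = ⟨w * u, hwu⟩ ^ q * ⟨_, hs'⟩ := by
    apply Subtype.ext
    simp only [MulMemClass.coe_mul, SubmonoidClass.coe_pow, hs, w, u, v, monomial_mul,
      monomial_pow, one_pow, one_mul]
    congr 2
    apply fin2_ext
    · simp
      nlinarith
    · simp
      nlinarith
  have h2 := congrArg φ key
  rw [hφ, hφ] at h2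
  have h3 := congrArg Subtype.val h2
  simp only [MulMemClass.coe_mul, mul_assoc] at h3
  have h4 := mul_left_cancel₀ (by simp [w] : w ≠ 0) h3
  have h5 := congrArg (coeff (expo (a', b'))) h4
  simp only [u, v] at h5
  rw [coeff_monomial_mul', coeff_monomial_mul', if_pos le_rfl, if_neg, tsub_self, one_mul] at h5
  · exact h5
  · intro hle
    have hle0 := hle 0
    have hle1 := hle 1
    simp at hle0 hle1
    omega

/-- The exponents of the monomials of `R` not divisible by `x ^ q` or `y ^ q`. -/
def smallExponents (δ q : ℕ) : Finset (ℕ × ℕ) :=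
  (Finset.range q ×ˢ Finset.range q).filter fun t => δ ∣ t.1 + t.2

/-- The constant coefficient on `R`. -/
def constR (δ : ℕ) : ↥(Rver k δ) →+* k := constantCoeff.comp (Rver k δ).val.toRingHom

/-- The monomial `x^i y^j` as an element of `R`, or `0` if it is not in `R`. -/
def monR (δ : ℕ) (m : Fin 2 →₀ ℕ) (c : k) : ↥(Rver k δ) :=
  open Classical in if h : monomial m c ∈ Rver k δ then ⟨monomial m c, h⟩ else 0

lemma coe_monR {δ : ℕ} (m : Fin 2 →₀ ℕ) (c : k) (h : δ ∣ m 0 + m 1) :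
    (monR k δ m c : MvPolynomial (Fin 2) k) = monomial m c := by
  rw [monR, dif_pos (monomial_mem_Rver k m c h)]

lemma eq_sum_monR {δ : ℕ} (f : ↥(Rver k δ)) :
    f = ∑ m ∈ f.1.support, monR k δ m (coeff m f.1) := by
  apply Subtype.ext
  conv_lhs => rw [← support_sum_monomial_coeff f.1]
  rw [AddSubmonoidClass.coe_finsetSum]
  refine Finset.sum_congr rfl fun m hm => ?_
  rw [coe_monR k]
  exact dvd_of_coeff_ne_zero k f.2 m (mem_support_iff.1 hm)

lemma card_le_smallExponents {δ q n : ℕ} (hδ : 0 < δ) (hq : 0 < q)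
    (hroot : ∀ c : k, ∃ d, d ^ q = c)
    (φ : Fin n → ↥(Rver k δ) →+ ↥(Rver k δ)) (hφ : ∀ l r s, φ l (r ^ q * s) = r * φ l s)
    (hsurj : ∀ l, ∃ s, ∀ l', φ l' s = (Pi.single l 1 : Fin n → ↥(Rver k δ)) l') :
    n ≤ (smallExponents δ q).card := by
  classical
  let V : (ℕ × ℕ) → Fin n → k := fun t l => constR k δ (φ l (monR k δ (expo t) 1))
  let W : Submodule k (Fin n → k) := Submodule.span k ((smallExponents δ q).image V)
  let Ψ : ↥(Rver k δ) →+ (Fin n → k) :=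
    { toFun := fun s l => constR k δ (φ l s)
      map_zero' := by ext; simp
      map_add' := by intros; ext; simp }
  have hΨ : ∀ f, Ψ f ∈ W := by
    intro f
    rw [eq_sum_monR k f, map_sum]
    refine Submodule.sum_mem _ fun m hm => ?_
    have hd : δ ∣ m 0 + m 1 := dvd_of_coeff_ne_zero k f.2 m (mem_support_iff.1 hm)
    by_cases hm' : q ≤ m 0 ∨ q ≤ m 1
    · convert W.zero_mem
      ext l
      exact coeff_zero_eq_zero k hδ hq (φ l) (hφ l) m _ hm' _ (coe_monR k _ _ hd) hd
    · push Not at hm'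
      obtain ⟨d, hd'⟩ := hroot (coeff m f.1)
      have h1 : monR k δ m (coeff m f.1)
          = (algebraMap k ↥(Rver k δ) d) ^ q * monR k δ (expo (m 0, m 1)) 1 := by
        have hm2 : expo (m 0, m 1) = m := fin2_ext (by simp) (by simp)
        rw [hm2]
        apply Subtype.ext
        simp only [MulMemClass.coe_mul, SubmonoidClass.coe_pow, coe_monR k _ _ hd,
          Subalgebra.coe_algebraMap, algebraMap_eq]
        rw [← C_pow, hd', C_mul_monomial, mul_one]
      have h2 : Ψ (monR k δ m (coeff m f.1)) = d • V (m 0, m 1) := by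
        ext l
        change constR k δ (φ l _) = d * constR k δ (φ l _)
        rw [h1, hφ, map_mul]
        congr 1
        simp [constR, algebraMap_eq]
      rw [h2]
      refine W.smul_mem _ (Submodule.subset_span ?_)
      rw [Finset.mem_coe]
      exact Finset.mem_image_of_mem _ (by simp [smallExponents, hm', hd])
  have htop : W = ⊤ := by
    rw [eq_top_iff, ← (Pi.basisFun k (Fin n)).span_eq, Submodule.span_le]
    rintro _ ⟨l, rfl⟩
    obtain ⟨s, hs⟩ := hsurj l
    suffices h : Pi.basisFun k (Fin n) l = Ψ s from h ▸ hΨ s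
    ext l'
    change _ = constR k δ (φ l' s)
    rw [hs, Pi.basisFun_apply]
    by_cases h : l' = l
    · subst h; simp
    · simp [h]
  have h1 := finrank_span_finset_le_card (R := k) ((smallExponents δ q).image V)
  rw [Set.finrank] at h1
  change Module.finrank k W ≤ _ at h1
  rw [htop, finrank_top, Module.finrank_fin_fun] at h1
  exact h1.trans Finset.card_image_le

/-- The additive map `S → S` sending `c ^ q * x^(q*a + i) * y^(q*b + j)` to `c * x^a * y^b` when
`δ ∣ a + b`, where `t = (i, j)`, and all other monomials to `0`. Here `g` is a `q`-th root. -/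
def component (δ q : ℕ) (g : k →+ k) (t : ℕ × ℕ) :
    MvPolynomial (Fin 2) k →+ MvPolynomial (Fin 2) k where
  toFun f := (AddMonoidAlgebra.coeff f).sum fun m c =>
    if (m 0 % q, m 1 % q) = t ∧ δ ∣ m 0 / q + m 1 / q then
      monomial (expo (m 0 / q, m 1 / q)) (g c) else 0
  map_zero' := by simp
  map_add' f₁ f₂ := by
    rw [AddMonoidAlgebra.coeff_add]
    refine Finsupp.sum_add_index' (fun m => by simp) fun m c d => ?_
    split_ifs <;> simp

lemma component_monomial (δ q : ℕ) (g : k →+ k) (t : ℕ × ℕ) (m : Fin 2 →₀ ℕ) (c : k) :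
    component k δ q g t (monomial m c) =
      if (m 0 % q, m 1 % q) = t ∧ δ ∣ m 0 / q + m 1 / q then
        monomial (expo (m 0 / q, m 1 / q)) (g c) else 0 := by
  change (Finsupp.single m c).sum (fun m c =>
    if (m 0 % q, m 1 % q) = t ∧ δ ∣ m 0 / q + m 1 / q then
      monomial (expo (m 0 / q, m 1 / q)) (g c) else 0) = _
  rw [Finsupp.sum_single_index]
  simp

lemma component_mem {δ q : ℕ} (g : k →+ k) (t : ℕ × ℕ)
    (f : MvPolynomial (Fin 2) k) : component k δ q g t f ∈ Rver k δ := by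
  induction f using MvPolynomial.induction_on' with
  | monomial m c =>
    rw [component_monomial]
    split_ifs with h
    · exact monomial_mem_Rver k _ _ (by simpa using h.2)
    · exact zero_mem _
  | add f₁ f₂ h₁ h₂ =>
    rw [map_add]
    exact add_mem h₁ h₂

lemma component_pow_mul (δ p e : ℕ) [Fact p.Prime] [CharP k p] (g : k →+ k)
    (hg : ∀ c d, g (c ^ p ^ e * d) = c * g d) (t : ℕ × ℕ)
    (r : ↥(Rver k δ)) (f : MvPolynomial (Fin 2) k) :
    component k δ (p ^ e) g t (r.1 ^ p ^ e * f) = r.1 * component k δ (p ^ e) g t f := by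
  have hq : 0 < p ^ e := pow_pos (Fact.out : p.Prime).pos e
  induction f using MvPolynomial.induction_on' with
  | add f₁ f₂ h₁ h₂ => rw [mul_add, map_add, map_add, mul_add, h₁, h₂]
  | monomial m c =>
    conv_lhs => rw [← support_sum_monomial_coeff r.1]
    conv_rhs => rw [← support_sum_monomial_coeff r.1]
    rw [sum_pow_char_pow, Finset.sum_mul, map_sum, Finset.sum_mul]
    refine Finset.sum_congr rfl fun n hn => ?_
    have hd : δ ∣ n 0 + n 1 := dvd_of_coeff_ne_zero k r.2 n (mem_support_iff.1 hn)
    rw [monomial_pow, monomial_mul, component_monomial, component_monomial, mul_ite, mul_zero,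
      monomial_mul, hg]
    have h0 : (p ^ e • n + m) 0 = m 0 + p ^ e * n 0 := by simp [add_comm]
    have h1 : (p ^ e • n + m) 1 = m 1 + p ^ e * n 1 := by simp [add_comm]
    rw [h0, h1, Nat.add_mul_mod_self_left, Nat.add_mul_mod_self_left,
      Nat.add_mul_div_left _ _ hq, Nat.add_mul_div_left _ _ hq]
    have hiff : δ ∣ m 0 / p ^ e + n 0 + (m 1 / p ^ e + n 1) ↔ δ ∣ m 0 / p ^ e + m 1 / p ^ e := by
      rw [add_add_add_comm]
      exact (Nat.dvd_add_iff_left hd).symm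
    have hexpo : expo (m 0 / p ^ e + n 0, m 1 / p ^ e + n 1)
        = n + expo (m 0 / p ^ e, m 1 / p ^ e) :=
      fin2_ext (by simp [add_comm]) (by simp [add_comm])
    simp only [hiff, hexpo]

section

variable {k}
universe v

variable (δ p : ℕ) [Fact p.Prime] [CharP k p] (e : ℕ)

/-- The identity map from `^eR` to `R`. -/
def eR.toR : ↥(eR k δ p e) ≃+ ↥(Rver k δ) := AddEquiv.refl _

lemma eR.toR_smul (r : ↥(Rver k δ)) (s : ↥(eR k δ p e)) :
    eR.toR δ p e (r • s) = r ^ p ^ e * eR.toR δ p e s := rfl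

/-- `component` as an `R`-linear form on `^eR`. -/
def eR.component (g : k →+ k) (hg : ∀ c d, g (c ^ p ^ e * d) = c * g d) (t : ℕ × ℕ) :
    ↥(eR k δ p e) →ₗ[↥(Rver k δ)] ↥(Rver k δ) where
  toFun s := ⟨_root_.component k δ (p ^ e) g t (eR.toR δ p e s).1, component_mem k g t _⟩
  map_add' s₁ s₂ := by
    apply Subtype.ext
    simp
  map_smul' r s := by
    apply Subtype.ext
    rw [eR.toR_smul]
    exact component_pow_mul k δ p e g hg t r _

lemma exists_equiv_prod [PerfectRing k p] :
    ∃ N : ModuleCat.{v} ↥(Rver k δ), Nonempty (↥(eR k δ p e) ≃ₗ[↥(Rver k δ)]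
      ((Fin (smallExponents δ (p ^ e)).card → ↥(Rver k δ)) × ↥N)) := by
  classical
  let F := (iterateFrobeniusEquiv k p e).symm
  have hF : ∀ c d : k, F (c ^ p ^ e * d) = c * F d := by
    intro c d
    rw [map_mul]
    congr 1
    exact (iterateFrobeniusEquiv k p e).symm_apply_apply c
  let T := smallExponents δ (p ^ e)
  let t : Fin T.card → ℕ × ℕ := fun i => (T.equivFin.symm i).1
  have ht : ∀ i, t i ∈ T := fun i => (T.equivFin.symm i).2
  have hinj : Function.Injective t := Subtype.val_injective.comp T.equivFin.symm.injective
  let π : ↥(eR k δ p e) →ₗ[↥(Rver k δ)] (Fin T.card → ↥(Rver k δ)) :=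
    LinearMap.pi fun i => eR.component δ p e (F : k →+ k) hF (t i)
  let σ : (Fin T.card → ↥(Rver k δ)) →ₗ[↥(Rver k δ)] ↥(eR k δ p e) :=
    (Pi.basisFun ↥(Rver k δ) (Fin T.card)).constr ℕ fun i =>
      (eR.toR δ p e).symm (monR k δ (expo (t i)) 1)
  have hπσ : π ∘ₗ σ = LinearMap.id := by
    refine (Pi.basisFun ↥(Rver k δ) (Fin T.card)).ext fun i => ?_
    rw [LinearMap.comp_apply, LinearMap.id_apply, Module.Basis.constr_basis]
    ext j : 1
    apply Subtype.ext
    change _root_.component k δ (p ^ e) (F : k →+ k) (t j) (monR k δ (expo (t i)) 1).1 = _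
    have hti := ht i
    simp only [T, smallExponents, Finset.mem_filter, Finset.mem_product, Finset.mem_range] at hti
    obtain ⟨⟨hi0, hi1⟩, hd⟩ := hti
    rw [coe_monR k _ _ (by simpa using hd), component_monomial, expo_zero, expo_one,
      Nat.mod_eq_of_lt hi0, Nat.mod_eq_of_lt hi1, Nat.div_eq_of_lt hi0, Nat.div_eq_of_lt hi1,
      Pi.basisFun_apply]
    by_cases hij : i = j
    · subst hij
      simp [expo]
    · have : t i ≠ t j := fun h => hij (hinj h)
      rw [if_neg (fun h => this h.1), Pi.single_eq_of_ne (Ne.symm hij)]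
      rfl
  have hex : Function.Exact π.ker.subtype π := LinearMap.exact_subtype_ker_map π
  obtain ⟨E, -⟩ := hex.splitSurjectiveEquiv (Submodule.injective_subtype _) ⟨σ, hπσ⟩
  exact ⟨ModuleCat.of _ (ULift.{v} π.ker), ⟨E ≪≫ₗ LinearEquiv.prodComm _ _ _ ≪≫ₗ
    LinearEquiv.prodCongr (LinearEquiv.refl _ _) ULift.moduleEquiv.symm⟩⟩

lemma card_le_of_equiv_prod [PerfectRing k p] (hδ : 0 < δ) {n : ℕ}
    (N : ModuleCat.{v} ↥(Rver k δ))
    (E : ↥(eR k δ p e) ≃ₗ[↥(Rver k δ)] ((Fin n → ↥(Rver k δ)) × ↥N)) :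
    n ≤ (smallExponents δ (p ^ e)).card := by
  refine card_le_smallExponents k hδ (pow_pos (Fact.out : p.Prime).pos e)
    (fun c => ⟨_, (iterateFrobeniusEquiv k p e).apply_symm_apply c⟩)
    (fun l => (((LinearMap.proj l ∘ₗ LinearMap.fst _ _ _) ∘ₗ E.toLinearMap).toAddMonoidHom).comp
      (eR.toR δ p e).symm.toAddMonoidHom) (fun l r s => ?_) (fun l => ?_)
  · exact congrFun (congrArg Prod.fst (E.map_smul r ((eR.toR δ p e).symm s))) l
  · refine ⟨eR.toR δ p e (E.symm (Pi.single l 1, 0)), fun l' => ?_⟩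
    change (E (E.symm (Pi.single l 1, 0))).1 l' = _
    rw [E.apply_symm_apply]

end

lemma card_smallExponents_bounds {δ : ℕ} (hδ : 0 < δ) (q : ℕ) :
    |((smallExponents δ q).card : ℝ) - (q : ℝ) ^ 2 / δ| ≤ q := by
  have h1 : (smallExponents δ q).card
      = ∑ i ∈ Finset.range q, ((Finset.range q).filter fun j => δ ∣ i + j).card := by
    rw [smallExponents, Finset.card_filter, Finset.sum_product]
    simp only [Finset.card_filter]
  have h2 : ∀ i, |(((Finset.range q).filter fun j => δ ∣ i + j).card : ℝ) - (q : ℝ) / δ| ≤ 1 := by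
    intro i
    have h3 : ((Finset.range q).filter fun j => δ ∣ i + j).card
        = q / δ + if ((δ - 1) * i) % δ < q % δ then 1 else 0 := by
      rw [← Nat.count_modEq_card q hδ, Nat.count_eq_card_filter_range]
      congr 1
      refine Finset.filter_congr fun j _ => ?_
      obtain ⟨d, rfl⟩ : ∃ d, δ = d + 1 := ⟨δ - 1, by omega⟩
      rw [Nat.add_sub_cancel, Nat.modEq_iff_dvd, ← Int.natCast_dvd_natCast]
      push_cast
      rw [← dvd_neg, ← dvd_add_right (dvd_mul_right ((d : ℤ) + 1) i)]
      ring_nf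
    have hδ' : (0 : ℝ) < δ := by exact_mod_cast hδ
    have h4 : (q : ℝ) / δ = (q / δ : ℕ) + ((q % δ : ℕ) : ℝ) / δ := by
      rw [div_eq_iff hδ'.ne', add_mul, div_mul_cancel₀ _ hδ'.ne']
      exact_mod_cast (Nat.div_add_mod' q δ).symm
    have h5 : ((q % δ : ℕ) : ℝ) / δ ≤ 1 := by
      rw [div_le_one hδ']
      exact_mod_cast (Nat.mod_lt q hδ).le
    have h6 : 0 ≤ ((q % δ : ℕ) : ℝ) / δ := by positivity
    rw [h3, h4, abs_le]
    split_ifs <;> push_cast <;> constructor <;> linarith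
  have h3 : (q : ℝ) ^ 2 / δ = ∑ _i ∈ Finset.range q, (q : ℝ) / δ := by
    rw [Finset.sum_const, Finset.card_range, nsmul_eq_mul]
    ring
  rw [h1, h3, Nat.cast_sum, ← Finset.sum_sub_distrib]
  refine (Finset.abs_sum_le_sum_abs _ _).trans ((Finset.sum_le_sum fun i _ => h2 i).trans ?_)
  simp

theorem fSignature_veronese (p : ℕ) [Fact p.Prime] (k : Type) [Field k] [IsAlgClosed k]
    [CharP k p] (δ : ℕ) (hδ : 2 ≤ δ) (a : ℕ → ℕ)
    (ha : ∀ e : ℕ, 1 ≤ e →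
      IsGreatest
        {n : ℕ | ∃ N : ModuleCat ↥(Rver k δ),
          Nonempty (↥(eR k δ p e) ≃ₗ[↥(Rver k δ)] ((Fin n → ↥(Rver k δ)) × ↥N))}
        (a e)) :
    Tendsto (fun e : ℕ => (a e : ℝ) / (p : ℝ) ^ (2 * e)) atTop (nhds (1 / δ)) := by
  have hp : 1 < p := (Fact.out : p.Prime).one_lt
  have hδ0 : 0 < δ := by omega
  have hae : ∀ e, 1 ≤ e → a e = (smallExponents δ (p ^ e)).card := by
    intro e he
    obtain ⟨⟨N, ⟨E⟩⟩, hub⟩ := ha e he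
    exact le_antisymm (card_le_of_equiv_prod δ p e hδ0 N E) (hub (exists_equiv_prod δ p e))
  have hp1 : (1 : ℝ) < p := by exact_mod_cast hp
  rw [tendsto_iff_dist_tendsto_zero]
  refine squeeze_zero' (.of_forall fun _ => dist_nonneg) ?_
    (tendsto_inv_atTop_zero.comp (tendsto_pow_atTop_atTop_of_one_lt hp1))
  filter_upwards [eventually_ge_atTop 1] with e he
  have hq : (0 : ℝ) < (p : ℝ) ^ e := by positivity
  have hb := card_smallExponents_bounds hδ0 (p ^ e)
  rw [← hae e he, Nat.cast_pow] at hb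
  have h1 : (a e : ℝ) / (p : ℝ) ^ (2 * e) - 1 / δ
      = ((a e : ℝ) - ((p : ℝ) ^ e) ^ 2 / δ) / ((p : ℝ) ^ e) ^ 2 := by
    rw [mul_comm 2 e, pow_mul]
    field_simp
  rw [Real.dist_eq, h1, abs_div, abs_of_pos (pow_pos hq 2), div_le_iff₀ (pow_pos hq 2)]
  refine hb.trans (le_of_eq ?_)
  simp only [Function.comp_apply]
  field_simp
end
end

section
/- Let k be an algebraically closed field of prime characteristic p, δ ≥ 2, and let q = p^e > δ. For 0 ≤ l ≤ δ−1 set a_l = #{(i,j) ∈ ℤ² : lq ≤ i < (l+1)q, 0 ≤ j < q, and δ divides i+j}. Then there is an isomorphism of R-modules ^eR ≅ ⊕_{l=0}^{δ−1} (M^(l))^(a_l). -/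
open MvPolynomial CategoryTheory Filter

set_option synthInstance.maxHeartbeats 1000000
set_option maxHeartbeats 2000000

noncomputable section

variable (k : Type) [Field k]

/-- The maximal Cohen-Macaulay module `M^(l) = ⊕_{n≥0} S_{nδ+l}`: the `R`-submodule of `S`
generated by `x^l, x^(l-1)y, …, y^l`. -/
def Mmod (δ l : ℕ) : Submodule ↥(Rver k δ) (MvPolynomial (Fin 2) k) :=
  Submodule.span ↥(Rver k δ) { g | ∃ m ≤ l, g = X 0 ^ (l - m) * X 1 ^ m }

/-- The number of lattice points `(i,j) ∈ ℤ²` with `lq ≤ i < (l+1)q`, `0 ≤ j < q`, and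
`δ ∣ i + j`. -/
def aCard (δ l q : ℕ) : ℕ :=
  (((Finset.Ico ((l : ℤ) * q) (((l : ℤ) + 1) * q)) ×ˢ Finset.Ico (0 : ℤ) q).filter
    (fun ij => (δ : ℤ) ∣ ij.1 + ij.2)).card

section Veronese

variable {k}

theorem Rver_smul_eq (δ : ℕ) (r : Rver k δ) (f : MvPolynomial (Fin 2) k) :
    r • f = (r : MvPolynomial (Fin 2) k) * f := rfl

theorem monomial_eq_C_mul_X_pow (d : Fin 2 →₀ ℕ) (c : k) :
    monomial d c = C c * (X 0 ^ d 0 * X 1 ^ d 1) := by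
  rw [monomial_eq, Finsupp.prod_fintype _ _ (by simp), Fin.prod_univ_two]

theorem coeff_X_pow_mul_X_pow_ne_zero {a b : ℕ} {d : Fin 2 →₀ ℕ}
    (h : coeff d (X 0 ^ a * X 1 ^ b : MvPolynomial (Fin 2) k) ≠ 0) : d 0 = a ∧ d 1 = b := by
  rw [X_pow_eq_monomial, X_pow_eq_monomial, monomial_mul, coeff_monomial] at h
  split_ifs at h with hd
  · subst hd
    simp
  · exact absurd rfl h

theorem X_pow_mul_X_pow_mem_Rver {δ : ℕ} (n : ℕ) :
    ∀ {a b : ℕ}, a + b = δ * n → (X 0 ^ a * X 1 ^ b : MvPolynomial (Fin 2) k) ∈ Rver k δ := by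
  induction n with
  | zero =>
    intro a b h
    obtain ⟨rfl, rfl⟩ : a = 0 ∧ b = 0 := by omega
    simp
  | succ n ih =>
    intro a b h
    rw [mul_add, mul_one] at h
    have hgen : (X 0 ^ (δ - min b δ) * X 1 ^ min b δ : MvPolynomial (Fin 2) k) ∈ Rver k δ :=
      Algebra.subset_adjoin ⟨min b δ, min_le_right _ _, rfl⟩
    have hrest := ih (a := a - (δ - min b δ)) (b := b - min b δ) (by omega)
    convert mul_mem hgen hrest using 1
    rw [mul_mul_mul_comm, ← pow_add, ← pow_add]
    congr 2 <;> omega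

theorem mem_Rver_iff {δ : ℕ} {f : MvPolynomial (Fin 2) k} :
    f ∈ Rver k δ ↔ ∀ d, coeff d f ≠ 0 → δ ∣ d 0 + d 1 := by
  constructor
  · intro hf
    induction hf using Algebra.adjoin_induction with
    | mem g hg =>
      obtain ⟨i, hi, rfl⟩ := hg
      intro d hd
      obtain ⟨h0, h1⟩ := coeff_X_pow_mul_X_pow_ne_zero hd
      rw [h0, h1, Nat.sub_add_cancel hi]
    | algebraMap c =>
      intro d hd
      rw [algebraMap_eq, coeff_C] at hd
      split_ifs at hd with h
      · simp [← h]
      · exact absurd rfl hd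
    | add f g _ _ hf hg =>
      intro d hd
      by_cases h : coeff d f = 0
      · refine hg d fun h' => hd ?_
        rw [coeff_add, h, h', add_zero]
      · exact hf d h
    | mul f g _ _ hf hg =>
      intro d hd
      rw [coeff_mul] at hd
      obtain ⟨⟨u, v⟩, huv, h⟩ := Finset.exists_ne_zero_of_sum_ne_zero hd
      rw [Finset.HasAntidiagonal.mem_antidiagonal] at huv
      have hu := hf u (left_ne_zero_of_mul h)
      have hv := hg v (right_ne_zero_of_mul h)
      rw [← huv, Finsupp.add_apply, Finsupp.add_apply, add_add_add_comm]
      exact dvd_add hu hv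
  · intro h
    rw [f.as_sum]
    refine sum_mem fun d hd => ?_
    obtain ⟨n, hn⟩ := h d (mem_support_iff.1 hd)
    rw [monomial_eq_C_mul_X_pow]
    exact mul_mem ((Rver k δ).algebraMap_mem _) (X_pow_mul_X_pow_mem_Rver n hn)

theorem mem_Mmod_iff {δ l : ℕ} (hl : l < δ) {f : MvPolynomial (Fin 2) k} :
    f ∈ Mmod k δ l ↔ ∀ d, coeff d f ≠ 0 → (d 0 + d 1) % δ = l := by
  constructor
  · intro hf
    induction hf using Submodule.span_induction with
    | mem g hg =>
      obtain ⟨m, hm, rfl⟩ := hg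
      intro d hd
      obtain ⟨h0, h1⟩ := coeff_X_pow_mul_X_pow_ne_zero hd
      rw [h0, h1, Nat.sub_add_cancel hm, Nat.mod_eq_of_lt hl]
    | zero => simp
    | add f g _ _ hf hg =>
      intro d hd
      by_cases h : coeff d f = 0
      · refine hg d fun h' => hd ?_
        rw [coeff_add, h, h', add_zero]
      · exact hf d h
    | smul r f _ hf =>
      intro d hd
      rw [Rver_smul_eq, coeff_mul] at hd
      obtain ⟨⟨u, v⟩, huv, h⟩ := Finset.exists_ne_zero_of_sum_ne_zero hd
      rw [Finset.HasAntidiagonal.mem_antidiagonal] at huv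
      obtain ⟨n, hn⟩ := mem_Rver_iff.1 r.2 u (left_ne_zero_of_mul h)
      rw [← huv, Finsupp.add_apply, Finsupp.add_apply, add_add_add_comm, hn,
        Nat.mul_add_mod]
      exact hf v (right_ne_zero_of_mul h)
  · intro h
    rw [f.as_sum]
    refine sum_mem fun d hd => ?_
    have hdl := h d (mem_support_iff.1 hd)
    have hdiv := Nat.div_add_mod (d 0 + d 1) δ
    rw [hdl] at hdiv
    set m := min (d 1) l
    have hR : (C (coeff d f) * (X 0 ^ (d 0 - (l - m)) * X 1 ^ (d 1 - m)) :
        MvPolynomial (Fin 2) k) ∈ Rver k δ :=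
      mul_mem ((Rver k δ).algebraMap_mem _)
        (X_pow_mul_X_pow_mem_Rver ((d 0 + d 1) / δ) (by omega))
    have hgen : (X 0 ^ (l - m) * X 1 ^ m : MvPolynomial (Fin 2) k) ∈ Mmod k δ l :=
      Submodule.subset_span ⟨m, min_le_right _ _, rfl⟩
    convert (Mmod k δ l).smul_mem ⟨_, hR⟩ hgen using 1
    rw [Rver_smul_eq, monomial_eq_C_mul_X_pow, mul_assoc, mul_mul_mul_comm, ← pow_add,
      ← pow_add]
    congr 3 <;> omega

end Veronese

section FrobeniusPushforward

/-- The lattice points counted by `aCard δ l q`, enumerated and translated by `(-lq, 0)`, as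
exponents of monomials. -/
def latticeExponent (δ l q : ℕ) (c : Fin (aCard δ l q)) : Fin 2 →₀ ℕ :=
  let P := (Finset.equivFinOfCardEq (n := aCard δ l q) rfl).symm c
  Finsupp.single 0 ((P : ℤ × ℤ).1 - l * q).toNat + Finsupp.single 1 (P : ℤ × ℤ).2.toNat

section LatticeExponent

variable {δ l q : ℕ}

theorem latticeExponent_spec (c : Fin (aCard δ l q)) :
    ∃ P : ℤ × ℤ, P = ((Finset.equivFinOfCardEq (n := aCard δ l q) rfl).symm c : ℤ × ℤ) ∧
      P.1 = l * q + latticeExponent δ l q c 0 ∧ P.2 = latticeExponent δ l q c 1 ∧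
      (∀ i, latticeExponent δ l q c i < q) ∧ (δ : ℤ) ∣ P.1 + P.2 := by
  refine ⟨_, rfl, ?_⟩
  unfold latticeExponent
  generalize (Finset.equivFinOfCardEq (n := aCard δ l q) rfl).symm c = P
  obtain ⟨⟨i, j⟩, hP⟩ := P
  simp only [Finset.mem_filter, Finset.mem_product, Finset.mem_Ico, add_mul, one_mul] at hP
  simp only [Fin.forall_fin_two, Finsupp.add_apply, Finsupp.single_eq_same, ne_eq, one_ne_zero,
    zero_ne_one, not_false_eq_true, Finsupp.single_eq_of_ne, add_zero, zero_add]
  refine ⟨?_, ?_, ⟨?_, ?_⟩, hP.2⟩ <;> omega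

theorem latticeExponent_lt (c : Fin (aCard δ l q)) (i : Fin 2) : latticeExponent δ l q c i < q := by
  obtain ⟨P, -, -, -, h, -⟩ := latticeExponent_spec c
  exact h i

theorem dvd_latticeExponent (c : Fin (aCard δ l q)) :
    δ ∣ l * q + (latticeExponent δ l q c 0 + latticeExponent δ l q c 1) := by
  obtain ⟨P, -, h1, h2, -, h⟩ := latticeExponent_spec c
  rw [h1, h2, add_assoc] at h
  exact_mod_cast h

theorem latticeExponent_injective : Function.Injective (latticeExponent δ l q) := by
  intro c c' h
  obtain ⟨P, hP, h1, h2, -⟩ := latticeExponent_spec c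
  obtain ⟨P', hP', h1', h2', -⟩ := latticeExponent_spec c'
  have hPP : P = P' := Prod.ext (by rw [h1, h1', h]) (by rw [h2, h2', h])
  rw [hP, hP'] at hPP
  exact (Finset.equivFinOfCardEq (n := aCard δ l q) rfl).symm.injective (Subtype.ext hPP)

theorem exists_latticeExponent_eq {r : Fin 2 →₀ ℕ} (hr : ∀ i, r i < q)
    (h : δ ∣ l * q + (r 0 + r 1)) : ∃ c, latticeExponent δ l q c = r := by
  have h0 := hr 0
  have h1 := hr 1
  have hP : ((l * q + r 0, r 1) : ℤ × ℤ) ∈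
      ((Finset.Ico ((l : ℤ) * q) (((l : ℤ) + 1) * q)) ×ˢ Finset.Ico (0 : ℤ) q).filter
        (fun ij => (δ : ℤ) ∣ ij.1 + ij.2) := by
    simp only [Finset.mem_filter, Finset.mem_product, Finset.mem_Ico, add_mul, one_mul]
    refine ⟨by omega, ?_⟩
    rw [add_assoc]
    exact_mod_cast h
  refine ⟨Finset.equivFinOfCardEq (n := aCard δ l q) rfl ⟨_, hP⟩, ?_⟩
  rw [latticeExponent, Equiv.symm_apply_apply]
  ext i
  fin_cases i <;> simp

end LatticeExponent

variable {k}
variable {δ : ℕ} {p : ℕ} [Fact p.Prime] [CharP k p] {e : ℕ}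

theorem coeff_pow_smul (g : MvPolynomial (Fin 2) k) (d : Fin 2 →₀ ℕ) :
    coeff (p ^ e • d) (g ^ p ^ e) = coeff d g ^ p ^ e := by
  rw [← map_iterateFrobenius_expand p, coeff_map, iterateFrobenius_def,
    coeff_expand_smul _ (pow_ne_zero _ (Fact.out : p.Prime).ne_zero)]

theorem coeff_pow_of_not_dvd (g : MvPolynomial (Fin 2) k) {d : Fin 2 →₀ ℕ} {i : Fin 2}
    (h : ¬ p ^ e ∣ d i) : coeff d (g ^ p ^ e) = 0 := by
  rw [← map_iterateFrobenius_expand p, coeff_map, coeff_expand_of_not_dvd _ h, map_zero]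

theorem coeff_monomial_mul_pow (g : MvPolynomial (Fin 2) k) (d : Fin 2 →₀ ℕ) {r r' : Fin 2 →₀ ℕ}
    (hr : ∀ i, r i < p ^ e) (hr' : ∀ i, r' i < p ^ e) :
    coeff (r + p ^ e • d) (monomial r' 1 * g ^ p ^ e) =
      if r' = r then coeff d g ^ p ^ e else 0 := by
  rw [coeff_monomial_mul', one_mul]
  by_cases h : r' = r
  · subst h
    rw [if_pos le_self_add, if_pos rfl, add_tsub_cancel_left, coeff_pow_smul]
  · rw [if_neg h]
    split_ifs with hle
    · obtain ⟨i, hi⟩ := DFunLike.ne_iff.1 h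
      refine coeff_pow_of_not_dvd (i := i) g ?_
      rintro ⟨m, hm⟩
      have hle' := hle i
      simp only [Finsupp.tsub_apply, Finsupp.add_apply, Finsupp.smul_apply, smul_eq_mul] at hm hle'
      have heq : r i + p ^ e * d i = r' i + p ^ e * m := by omega
      have hmod := congrArg (· % p ^ e) heq
      simp only [Nat.add_mul_mod_self_left, Nat.mod_eq_of_lt (hr i),
        Nat.mod_eq_of_lt (hr' i)] at hmod
      exact hi hmod.symm
    · rfl

theorem monomial_mul_pow_mem_Rver {l : ℕ} (hl : l < δ) {r : Fin 2 →₀ ℕ}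
    (hdvd : δ ∣ l * p ^ e + (r 0 + r 1)) {g : MvPolynomial (Fin 2) k} (hg : g ∈ Mmod k δ l) :
    monomial r 1 * g ^ p ^ e ∈ Rver k δ := by
  rw [g.as_sum, sum_pow_char_pow, Finset.mul_sum]
  refine sum_mem fun d hd => ?_
  rw [monomial_pow, monomial_mul, one_mul, monomial_eq_C_mul_X_pow]
  refine mul_mem ((Rver k δ).algebraMap_mem _) ?_
  have hdl := (mem_Mmod_iff hl).1 hg d (mem_support_iff.1 hd)
  have hdiv := Nat.div_add_mod (d 0 + d 1) δ
  rw [hdl] at hdiv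
  obtain ⟨m, hm⟩ := hdvd
  refine X_pow_mul_X_pow_mem_Rver (p ^ e * ((d 0 + d 1) / δ) + m) ?_
  simp only [Finsupp.add_apply, Finsupp.smul_apply, smul_eq_mul]
  linear_combination p ^ e * hdiv.symm + hm

theorem coe_frobR (r : Rver k δ) :
    (frobR k δ p e r : MvPolynomial (Fin 2) k) = (r : MvPolynomial (Fin 2) k) ^ p ^ e := by
  simp only [frobR, iterateFrobenius_def, SubmonoidClass.coe_pow]

/-- The decomposition map `(g_{l,c}) ↦ ∑ x^i y^j g_{l,c}^q`, with `(lq + i, j)` running over the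
lattice points counted by `aCard δ l q`. -/
def frobeniusSum (δ p e : ℕ) [Fact p.Prime] [CharP k p] :
    ((l : Fin δ) → Fin (aCard δ l (p ^ e)) → Mmod k δ l) →ₛₗ[frobR k δ p e] Rver k δ where
  toFun g := ∑ l : Fin δ, ∑ c, ⟨_, monomial_mul_pow_mem_Rver l.2
    (dvd_latticeExponent (q := p ^ e) c) (g l c).2⟩
  map_add' f g := by
    simp only [← Finset.sum_add_distrib]
    refine Finset.sum_congr rfl fun l _ => Finset.sum_congr rfl fun c _ => Subtype.ext ?_
    simp [add_pow_char_pow, mul_add]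
  map_smul' r g := by
    simp only [Finset.smul_sum]
    refine Finset.sum_congr rfl fun l _ => Finset.sum_congr rfl fun c _ => Subtype.ext ?_
    simp only [Pi.smul_apply, Submodule.coe_smul, Rver_smul_eq, smul_eq_mul, MulMemClass.coe_mul,
      coe_frobR, mul_pow]
    ring

theorem coe_frobeniusSum (g : (l : Fin δ) → Fin (aCard δ l (p ^ e)) → Mmod k δ l) :
    (frobeniusSum δ p e g : MvPolynomial (Fin 2) k) =
      ∑ l : Fin δ, ∑ c, monomial (latticeExponent δ l (p ^ e) c) 1 *
        (g l c : MvPolynomial (Fin 2) k) ^ p ^ e := by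
  simp [frobeniusSum]

theorem coeff_frobeniusSum (g : (l : Fin δ) → Fin (aCard δ l (p ^ e)) → Mmod k δ l)
    {l : Fin δ} (c : Fin (aCard δ l (p ^ e))) {d : Fin 2 →₀ ℕ} (hd : (d 0 + d 1) % δ = l) :
    coeff (latticeExponent δ l (p ^ e) c + p ^ e • d)
      (frobeniusSum δ p e g : MvPolynomial (Fin 2) k) =
        coeff d (g l c : MvPolynomial (Fin 2) k) ^ p ^ e := by
  have hp : p ^ e ≠ 0 := pow_ne_zero _ (Fact.out : p.Prime).ne_zero
  rw [coe_frobeniusSum]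
  simp only [coeff_sum,
    coeff_monomial_mul_pow _ d (latticeExponent_lt c) (latticeExponent_lt _)]
  rw [Finset.sum_eq_single l, Finset.sum_eq_single c, if_pos rfl]
  · intro c' _ hc'
    exact if_neg fun h => hc' (latticeExponent_injective h)
  · simp
  · intro l' _ hl'
    refine Finset.sum_eq_zero fun c' _ => ?_
    have h0 : coeff d (g l' c' : MvPolynomial (Fin 2) k) = 0 := by
      by_contra h
      exact hl' (Fin.ext (((mem_Mmod_iff l'.2).1 (g l' c').2 d h).symm.trans hd))
    rw [h0, zero_pow hp, ite_self]
  · simp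

theorem frobeniusSum_injective : Function.Injective (frobeniusSum (k := k) δ p e) := by
  rw [injective_iff_map_eq_zero]
  intro g hg
  funext l c
  refine Subtype.ext (MvPolynomial.ext _ _ fun d => ?_)
  by_contra h
  have hc := coeff_frobeniusSum g c ((mem_Mmod_iff l.2).1 (g l c).2 d h)
  rw [hg, ZeroMemClass.coe_zero, coeff_zero] at hc
  exact h (eq_zero_of_pow_eq_zero hc.symm)

theorem frobeniusSum_single {l : Fin δ} (c : Fin (aCard δ l (p ^ e))) (m : Mmod k δ l) :
    (frobeniusSum δ p e (Pi.single l (Pi.single c m)) : MvPolynomial (Fin 2) k) =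
      monomial (latticeExponent δ l (p ^ e) c) 1 * (m : MvPolynomial (Fin 2) k) ^ p ^ e := by
  have hp : p ^ e ≠ 0 := pow_ne_zero _ (Fact.out : p.Prime).ne_zero
  rw [coe_frobeniusSum, Finset.sum_eq_single l, Finset.sum_eq_single c]
  · simp
  · intro c' _ hc'
    simp [hc', zero_pow hp]
  · simp
  · intro l' _ hl'
    simp [hl', zero_pow hp]
  · simp

theorem monomial_mem_range_frobeniusSum [IsAlgClosed k] (hδ : 0 < δ) {d : Fin 2 →₀ ℕ}
    (hd : δ ∣ d 0 + d 1) (a : k) :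
    ∃ g, ((frobeniusSum δ p e g : Rver k δ) : MvPolynomial (Fin 2) k) = monomial d a := by
  have hp : 0 < p ^ e := pow_pos (Fact.out : p.Prime).pos _
  obtain ⟨b, rfl⟩ := IsAlgClosed.exists_pow_nat_eq a hp
  set quo : Fin 2 →₀ ℕ := d.mapRange (· / p ^ e) (Nat.zero_div _) with hquo
  set rem : Fin 2 →₀ ℕ := d.mapRange (· % p ^ e) (Nat.zero_mod _) with hrem
  have hdecomp : rem + p ^ e • quo = d := by
    ext i
    simp [hquo, hrem, Nat.mod_add_div]
  let l : Fin δ := ⟨(quo 0 + quo 1) % δ, Nat.mod_lt _ hδ⟩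
  have hdvd : δ ∣ (l : ℕ) * p ^ e + (rem 0 + rem 1) := by
    have hdiv := Nat.mod_add_div (quo 0 + quo 1) δ
    rw [← hdecomp] at hd
    simp only [Finsupp.add_apply, Finsupp.smul_apply, smul_eq_mul] at hd
    have heq : rem 0 + p ^ e * quo 0 + (rem 1 + p ^ e * quo 1) =
        (l : ℕ) * p ^ e + (rem 0 + rem 1) + δ * ((quo 0 + quo 1) / δ * p ^ e) := by
      linear_combination p ^ e * hdiv.symm
    rw [heq] at hd
    exact (Nat.dvd_add_left (dvd_mul_right _ _)).1 hd
  obtain ⟨c, hc⟩ := exists_latticeExponent_eq (fun i => Nat.mod_lt (d i) hp) hdvd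
  have hmem : monomial quo b ∈ Mmod k δ l := by
    refine (mem_Mmod_iff l.2).2 fun u hu => ?_
    rw [coeff_monomial] at hu
    split_ifs at hu with h
    · rw [← h]
    · exact absurd rfl hu
  refine ⟨Pi.single l (Pi.single c ⟨_, hmem⟩), ?_⟩
  rw [frobeniusSum_single, hc, monomial_pow, monomial_mul, one_mul, hdecomp]

theorem frobeniusSum_surjective [IsAlgClosed k] (hδ : 0 < δ) :
    Function.Surjective (frobeniusSum (k := k) δ p e) := by
  intro f
  have hf := mem_Rver_iff.1 f.2
  choose! g hg using fun (d : Fin 2 →₀ ℕ) (hd : coeff d (f : MvPolynomial (Fin 2) k) ≠ 0) =>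
    monomial_mem_range_frobeniusSum (p := p) (e := e) hδ (hf d hd)
      (coeff d (f : MvPolynomial (Fin 2) k))
  refine ⟨∑ d ∈ (f : MvPolynomial (Fin 2) k).support, g d, Subtype.ext ?_⟩
  rw [map_sum, AddSubmonoidClass.coe_finsetSum]
  conv_rhs => rw [(f : MvPolynomial (Fin 2) k).as_sum]
  exact Finset.sum_congr rfl fun d hd => hg d (mem_support_iff.1 hd)

end FrobeniusPushforward

theorem eR_iso_directSum_Mmod (p : ℕ) [Fact p.Prime] (k : Type) [Field k] [IsAlgClosed k]
    [CharP k p] (δ : ℕ) (hδ : 2 ≤ δ) (e : ℕ) (hq : δ < p ^ e) :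
    Nonempty (↥(eR k δ p e) ≃ₗ[↥(Rver k δ)]
      ((l : Fin δ) → Fin (aCard δ l (p ^ e)) → ↥(Mmod k δ l))) := by
  let φ : ((l : Fin δ) → Fin (aCard δ l (p ^ e)) → ↥(Mmod k δ l)) →ₗ[↥(Rver k δ)]
      ↥(eR k δ p e) :=
    { toFun := frobeniusSum δ p e
      map_add' := map_add (frobeniusSum δ p e)
      map_smul' := map_smulₛₗ (frobeniusSum δ p e) }
  exact ⟨(LinearEquiv.ofBijective φ
    ⟨frobeniusSum_injective, frobeniusSum_surjective (by omega)⟩).symm⟩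
end
end
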